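/- Given an SLT grammar G and a subset R of the nodes of val(G), there exists a straight-line program (SLP) of size O(|G|·|R|) that generates the concatenation, in pre-order of the nodes of R, of the serializations of the subtrees of val(G) rooted at the nodes in R. -/

import Mathlib

/-- Trees over terminal labels `L`, nonterminals `N`, the leaf symbol `_`
(constructor `leaf`) and parameters `y_i` (constructor `param i`, 1-indexed).
Terminal-labeled nodes have exactly two children; a nonterminal node has a
list of children (its length being constrained by `ArityOk`). -/
inductive PTree (L N : Type) where
  | leaf : PTree L N
  | param : ℕ → PTree L N
  | term : L → PTree L N → PTree L N → PTree L N
  | nt : N → List (PTree L N) → PTree L N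

namespace PTree

variable {L N : Type}

/-- The pre-order list of parameter indices occurring in a tree. -/
def paramList : PTree L N → List ℕ
  | .leaf => []
  | .param i => [i]
  | .term _ l r => paramList l ++ paramList r
  | .nt _ ts => (ts.attach.map (fun t => paramList t.1)).flatten
decreasing_by
  all_goals simp_wf
  all_goals try omega
  all_goals (have := List.sizeOf_lt_of_mem t.2; omega)

/-- The number of nodes of a tree. -/
def nodeCount : PTree L N → ℕ
  | .leaf => 1
  | .param _ => 1
  | .term _ l r => 1 + nodeCount l + nodeCount r
  | .nt _ ts => 1 + (ts.attach.map (fun t => nodeCount t.1)).sum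
decreasing_by
  all_goals simp_wf
  all_goals try omega
  all_goals (have := List.sizeOf_lt_of_mem t.2; omega)

/-- Arities are respected: every nonterminal node labeled `A` has exactly
`rank A` children. -/
inductive ArityOk (rank : N → ℕ) : PTree L N → Prop
  | leaf : ArityOk rank .leaf
  | param (i : ℕ) : ArityOk rank (.param i)
  | term (a : L) {l r : PTree L N} :
      ArityOk rank l → ArityOk rank r → ArityOk rank (.term a l r)
  | nt (A : N) {ts : List (PTree L N)} :
      ts.length = rank A → (∀ t ∈ ts, ArityOk rank t) → ArityOk rank (.nt A ts)

/-- `Occurs B t` holds iff the nonterminal `B` occurs somewhere in `t`. -/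
inductive Occurs (B : N) : PTree L N → Prop
  | here (ts : List (PTree L N)) : Occurs B (.nt B ts)
  | nt (A : N) {ts : List (PTree L N)} {t : PTree L N} :
      t ∈ ts → Occurs B t → Occurs B (.nt A ts)
  | term_left (a : L) {l r : PTree L N} : Occurs B l → Occurs B (.term a l r)
  | term_right (a : L) {l r : PTree L N} : Occurs B r → Occurs B (.term a l r)

/-- Ground trees: binary trees built from terminal symbols and `_`-leaves only
(no nonterminals, no parameters). -/
inductive Ground : PTree L N → Prop
  | leaf : Ground .leaf
  | term (a : L) {l r : PTree L N} : Ground l → Ground r → Ground (.term a l r)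

/-- Substitution of the parameters `y_1, …, y_k` by the trees of `env`
(`y_i` is replaced by the `i`-th entry of `env`). -/
def subst (env : List (PTree L N)) : PTree L N → PTree L N
  | .leaf => .leaf
  | .param i => env.getD (i - 1) .leaf
  | .term a l r => .term a (subst env l) (subst env r)
  | .nt B ts => .nt B (ts.attach.map (fun t => subst env t.1))
decreasing_by
  all_goals simp_wf
  all_goals try omega
  all_goals (have := List.sizeOf_lt_of_mem t.2; omega)

end PTree

open PTree in
/-- A straight-line (linear) tree grammar `G = (N, S, P)`:
each nonterminal `A` of rank `k` has exactly one production `A → P A`, in whose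
right-hand side the parameters `y_1, …, y_k` occur exactly once each and
in this order in pre-order, all arities are respected, and the hierarchical
order `H_G = {(A, B) | B occurs in P A}` is acyclic. -/
structure SLT (L N : Type) where
  rank : N → ℕ
  start : N
  P : N → PTree L N
  rank_start : rank start = 0
  arity : ∀ A, ArityOk rank (P A)
  params : ∀ A, paramList (P A) = List.range' 1 (rank A)
  acyclic : ∀ A, ¬ Relation.TransGen (fun X Y => Occurs Y (P X)) A A

namespace SLT

variable {L N : Type}

/-- One derivation step: replace one occurrence of a subtree `A(t_1, …, t_k)`
(`A` a nonterminal) by `P A` with each parameter `y_i` replaced by `t_i`. -/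
inductive Rw (G : SLT L N) : PTree L N → PTree L N → Prop
  | head (A : N) (ts : List (PTree L N)) :
      Rw G (.nt A ts) (PTree.subst ts (G.P A))
  | term_left {l l' : PTree L N} (a : L) (r : PTree L N) :
      Rw G l l' → Rw G (.term a l r) (.term a l' r)
  | term_right {r r' : PTree L N} (a : L) (l : PTree L N) :
      Rw G r r' → Rw G (.term a l r) (.term a l r')
  | nt_child {t t' : PTree L N} (B : N) (u v : List (PTree L N)) :
      Rw G t t' → Rw G (.nt B (u ++ t :: v)) (.nt B (u ++ t' :: v))

/-- The size of a grammar: the sum of the numbers of edges of all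
right-hand sides. -/
def size [Fintype N] (G : SLT L N) : ℕ :=
  ∑ A : N, (PTree.nodeCount (G.P A) - 1)

end SLT

/-- A straight-line program (SLP): a context-free string grammar over terminal
alphabet `Γ` with nonterminal set `V` in which every nonterminal `v` has
exactly one production `v → P v` and the derivation relation among
nonterminals is acyclic. -/
structure SLP (Γ V : Type) where
  start : V
  P : V → List (Γ ⊕ V)
  acyclic : ∀ v, ¬ Relation.TransGen (fun x y => Sum.inr y ∈ P x) v v

namespace SLP

variable {Γ V : Type}

/-- One derivation step of an SLP: replace one occurrence of a nonterminal by
its right-hand side. -/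
inductive Rw (H : SLP Γ V) : List (Γ ⊕ V) → List (Γ ⊕ V) → Prop
  | step (u : List (Γ ⊕ V)) (v : V) (w : List (Γ ⊕ V)) :
      Rw H (u ++ Sum.inr v :: w) (u ++ H.P v ++ w)

/-- The SLP generates the string `s` (the unique string derivable from its
start nonterminal). -/
def Generates (H : SLP Γ V) (s : List Γ) : Prop :=
  Relation.ReflTransGen (Rw H) [Sum.inr H.start] (s.map Sum.inl)

/-- The size of an SLP: the total length of all right-hand sides. -/
def size [Fintype V] (H : SLP Γ V) : ℕ :=
  ∑ v : V, (H.P v).length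

end SLP

/-- The serialization of a (ground) tree: the string of opening brackets
`<a>` (encoded `(a, false)`) and closing brackets `</a>` (encoded
`(a, true)`) produced by the depth-first left-to-right traversal, the
`_`-leaves contributing nothing. -/
def PTree.serialize {L N : Type} : PTree L N → List (L × Bool)
  | .leaf => []
  | .param _ => []
  | .term a l r => (a, false) :: (serialize l ++ serialize r ++ [(a, true)])
  | .nt _ _ => []

namespace PTree

variable {L N : Type}

/-- The subtree of a (ground) tree rooted at a position
(`false` = left child, `true` = right child). -/
def subtreeAt : PTree L N → List Bool → PTree L N
  | t, [] => t
  | .term _ l r, b :: p => subtreeAt (if b then r else l) p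
  | t, _ :: _ => t

/-- Whether a position is a node of a (ground) tree. -/
def ValidPos : PTree L N → List Bool → Prop
  | _, [] => True
  | .term _ l r, b :: p => ValidPos (if b then r else l) p
  | _, _ :: _ => False

end PTree

/-- Strict pre-order (document order) on positions of a binary tree: `u`
comes before `v` iff `u` is a proper prefix (ancestor) of `v`, or `u` lies in
the left subtree and `v` in the right subtree of their common ancestor. -/
def preLt (u v : List Bool) : Prop :=
  (u <+: v ∧ u ≠ v) ∨ ∃ w x y, u = w ++ false :: x ∧ v = w ++ true :: y

theorem Finset.univ_of_acyclic_induction {α : Type*} [Fintype α] [DecidableEq α] {r : α → α → Prop}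
    (hr : ∀ a, ¬ Relation.TransGen r a a) {motive : Finset α → Prop} (empty : motive ∅)
    (insert : ∀ (S : Finset α) (a : α), a ∉ S → (∀ b ∈ S, ∀ c, r b c → c ∈ S) →
      (∀ b, r a b → b ∈ S) → motive S → motive (insert a S)) : motive Finset.univ := by
  suffices h : ∀ n ≤ Fintype.card α, ∃ S : Finset α, S.card = n ∧
      (∀ b ∈ S, ∀ c, r b c → c ∈ S) ∧ motive S by
    obtain ⟨S, hS, -, hm⟩ := h _ le_rfl
    rwa [(Finset.card_eq_iff_eq_univ S).1 hS] at hm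
  intro n
  induction n with
  | zero => exact fun _ => ⟨∅, rfl, by simp, empty⟩
  | succ n ih =>
    intro hn
    obtain ⟨S, hS, hclosed, hm⟩ := ih (by omega)
    let q : α → α → Prop := fun x y => Relation.TransGen r y x
    have : IsTrans α q := ⟨fun _ _ _ h₁ h₂ => h₂.trans h₁⟩
    have : Std.Irrefl q := ⟨hr⟩
    have hwf : WellFounded q := Finite.wellFounded_of_trans_of_irrefl q
    have hne : {x | x ∉ S}.Nonempty := by
      by_contra h
      have : S = Finset.univ := by
        ext x
        by_contra hx
        exact h ⟨x, by simpa using hx⟩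
      rw [this, Finset.card_univ] at hS
      omega
    obtain ⟨a, ha, hmin⟩ := hwf.has_min _ hne
    have hsucc : ∀ b, r a b → b ∈ S := fun b hb => by
      by_contra h
      exact hmin b h (.single hb)
    refine ⟨Insert.insert a S, by rw [Finset.card_insert_of_notMem ha, hS], ?_,
      insert S a ha hclosed hsucc hm⟩
    intro b hb c hc
    rcases Finset.mem_insert.1 hb with rfl | hb
    · exact Finset.mem_insert_of_mem (hsucc c hc)
    · exact Finset.mem_insert_of_mem (hclosed b hb c hc)

/-- The strings in a list that are available as building blocks, together with single letters. -/
def IsPiece {Γ : Type} (W : List (List Γ)) (w : List Γ) : Prop :=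
  w ∈ W ∨ ∃ a, w = [a]

theorem IsPiece.mono {Γ : Type} {W W' : List (List Γ)} (h : ∀ w ∈ W, w ∈ W') {w : List Γ} :
    IsPiece W w → IsPiece W' w :=
  Or.imp_left (h w)

/-- `Straight W c` means that the strings of `W` can be built one after the other (from the last to
the first), each one as a concatenation of letters and previously built strings, using `c` factors
in total. -/
inductive Straight {Γ : Type} : List (List Γ) → ℕ → Prop
  | nil : Straight [] 0
  | cons {W : List (List Γ)} {c : ℕ} (ps : List (List Γ)) :
      Straight W c → (∀ p ∈ ps, IsPiece W p) → Straight (ps.flatten :: W) (c + ps.length)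

namespace Straight

variable {Γ : Type} {W : List (List Γ)} {c : ℕ}

theorem append {W' : List (List Γ)} {c' : ℕ} (h : Straight W c) (h' : Straight W' c') :
    Straight (W ++ W') (c + c') := by
  induction h with
  | nil => simpa using h'
  | cons ps _ hps ih =>
    have := ih.cons ps fun p hp => (hps p hp).mono fun w hw => List.mem_append_left _ hw
    rwa [Nat.add_right_comm]

theorem append_flatten (h : Straight W c) :
    ∀ pss : List (List (List Γ)), (∀ ps ∈ pss, ∀ p ∈ ps, IsPiece W p) →
      Straight (pss.map List.flatten ++ W) (c + (pss.map List.length).sum)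
  | [], _ => by simpa using h
  | ps :: pss, hp => by
    have := (append_flatten h pss fun qs hqs => hp qs (by simp [hqs])).cons ps fun p hpp =>
      (hp ps (by simp) p hpp).mono fun w hw => List.mem_append_right _ hw
    simpa [Nat.add_assoc, Nat.add_comm, Nat.add_left_comm] using this

theorem map_reverse (h : Straight W c) : Straight (W.map List.reverse) c := by
  induction h with
  | nil => exact .nil
  | cons ps _ hps ih =>
    have := ih.cons (ps.map List.reverse).reverse fun p hp => by
      simp only [List.mem_reverse, List.mem_map] at hp
      obtain ⟨q, hq, rfl⟩ := hp
      rcases hps q hq with h | ⟨a, rfl⟩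
      · exact Or.inl (List.mem_map_of_mem h)
      · exact Or.inr ⟨a, rfl⟩
    simpa [List.reverse_flatten] using this

theorem _root_.List.prefix_flatten {u : List Γ} :
    ∀ {ps : List (List Γ)}, u <+: ps.flatten →
      u = [] ∨ ∃ l p r u', ps = l ++ p :: r ∧ u' <+: p ∧ u = l.flatten ++ u'
  | [], h => by simpa using h
  | p :: ps, h => by
    rcases List.prefix_or_prefix_of_prefix h (List.prefix_append p ps.flatten) with hp | ⟨v, rfl⟩
    · exact Or.inr ⟨[], p, ps, u, rfl, hp, rfl⟩
    · rw [List.flatten_cons, List.prefix_append_right_inj] at h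
      rcases prefix_flatten h with rfl | ⟨l, q, r, u', rfl, hu', rfl⟩
      · exact Or.inr ⟨[], p, ps, p, rfl, List.prefix_rfl, by simp⟩
      · exact Or.inr ⟨p :: l, q, r, u', rfl, hu', by simp⟩

theorem exists_of_isPrefix_mem (h : Straight W c) {w u : List Γ} (hw : w ∈ W) (hu : u <+: w) :
    ∃ W' c', Straight W' c' ∧ c' ≤ 2 * c ∧ (∀ x ∈ W, x ∈ W') ∧ u ∈ W' := by
  induction h generalizing w u with
  | nil => simp at hw
  | @cons W c ps h hps ih =>
    rcases List.mem_cons.1 hw with rfl | hw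
    · obtain ⟨W', c', h', hc', hsub, qs, hqs, hlen, rfl⟩ : ∃ W' c', Straight W' c' ∧ c' ≤ 2 * c ∧
          (∀ x ∈ W, x ∈ W') ∧ ∃ qs : List (List Γ), (∀ q ∈ qs, IsPiece W' q) ∧
            qs.length ≤ ps.length ∧ u = qs.flatten := by
        rcases List.prefix_flatten hu with rfl | ⟨l, p, r, u', rfl, hu', rfl⟩
        · exact ⟨W, c, h, by omega, fun _ => id, [], by simp⟩
        rcases hps p (by simp) with hp | ⟨a, rfl⟩
        · obtain ⟨W', c', h', hc', hsub, hmem⟩ := ih hp hu'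
          refine ⟨W', c', h', hc', hsub, l ++ [u'], fun q hq => ?_, by simp, by simp⟩
          rcases List.mem_append.1 hq with hq | hq
          · exact (hps q (by simp [hq])).mono hsub
          · exact .inl (by rwa [List.mem_singleton.1 hq])
        · have hl : ∀ q ∈ l, IsPiece W q := fun q hq => hps q (by simp [hq])
          rcases u' with - | ⟨b, u'⟩
          · exact ⟨W, c, h, by omega, fun _ => id, l, hl, by simp, by simp⟩
          · obtain ⟨rfl, rfl⟩ : b = a ∧ u' = [] := by simpa using hu'
            refine ⟨W, c, h, by omega, fun _ => id, l ++ [[b]], fun q hq => ?_, by simp, by simp⟩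
            rcases List.mem_append.1 hq with hq | hq
            · exact hl q hq
            · exact .inr ⟨b, List.mem_singleton.1 hq⟩
      refine ⟨_, _, (h'.cons ps fun p hp => (hps p hp).mono hsub).cons qs fun q hq =>
        (hqs q hq).mono fun _ => List.mem_cons_of_mem _, by omega, ?_, by simp⟩
      intro x hx
      rcases List.mem_cons.1 hx with rfl | hx
      · simp
      · simp [hsub x hx]
    · obtain ⟨W', c', h', hc', hsub, hmem⟩ := ih hw hu
      refine ⟨_, _, h'.cons ps fun p hp => (hps p hp).mono hsub, by omega, ?_, by simp [hmem]⟩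
      intro x hx
      rcases List.mem_cons.1 hx with rfl | hx
      · simp
      · simp [hsub x hx]

theorem exists_of_isInfix_mem (h : Straight W c) {w u : List Γ} (hw : w ∈ W) (hu : u <:+: w) :
    ∃ W' c', Straight W' c' ∧ c' ≤ 4 * c ∧ u ∈ W' := by
  obtain ⟨l, r, rfl⟩ := hu
  obtain ⟨W₁, c₁, h₁, hc₁, -, hmem₁⟩ := h.exists_of_isPrefix_mem hw (List.prefix_append (l ++ u) r)
  obtain ⟨W₂, c₂, h₂, hc₂, -, hmem₂⟩ := h₁.map_reverse.exists_of_isPrefix_mem (u := u.reverse)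
    (List.mem_map_of_mem hmem₁) (by simp)
  refine ⟨_, c₂, h₂.map_reverse, by omega, ?_⟩
  simpa using List.mem_map_of_mem (f := List.reverse) hmem₂

theorem exists_flatten {b : ℕ} {us : List (List Γ)}
    (hus : ∀ u ∈ us, ∃ W c, Straight W c ∧ c ≤ b ∧ u ∈ W) :
    ∃ W c, Straight W c ∧ c ≤ us.length * (b + 1) ∧ us.flatten ∈ W := by
  suffices h : ∃ W c, Straight W c ∧ c ≤ us.length * b ∧ ∀ u ∈ us, u ∈ W by
    obtain ⟨W, c, h, hc, hmem⟩ := h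
    exact ⟨_, _, h.cons us fun u hu => .inl (hmem u hu), by rw [Nat.mul_succ]; omega, by simp⟩
  induction us with
  | nil => exact ⟨[], 0, .nil, by simp⟩
  | cons u us ih =>
    obtain ⟨W₁, c₁, h₁, hc₁, hmem₁⟩ := hus u (by simp)
    obtain ⟨W₂, c₂, h₂, hc₂, hmem₂⟩ := ih fun v hv => hus v (by simp [hv])
    refine ⟨_, _, h₁.append h₂, by rw [List.length_cons, Nat.succ_mul]; omega, ?_⟩
    intro v hv
    rcases List.mem_cons.1 hv with rfl | hv
    · exact List.mem_append_left _ hmem₁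
    · exact List.mem_append_right _ (hmem₂ v hv)

theorem exists_rules (h : Straight W c) :
    ∃ (m : ℕ) (P : Fin m → List (Γ ⊕ Fin m)) (e : Fin m → List Γ),
      (∀ x y, Sum.inr y ∈ P x → x < y) ∧ ∑ x, (P x).length = c ∧
      (∀ x, e x = (P x).flatMap (Sum.elim (fun a => [a]) e)) ∧ ∀ w ∈ W, ∃ x, e x = w := by
  induction h with
  | nil => exact ⟨0, Fin.elim0, Fin.elim0, by simp⟩
  | @cons W c ps h hps ih =>
    obtain ⟨m, P, e, hlt, hsum, he, hW⟩ := ih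
    have hps' : ∀ p ∈ ps, ∃ x, Sum.elim (fun a => [a]) e x = p := fun p hp => by
      rcases hps p hp with hp | ⟨a, rfl⟩
      · obtain ⟨x, hx⟩ := hW p hp
        exact ⟨.inr x, hx⟩
      · exact ⟨.inl a, rfl⟩
    obtain ⟨qs, hqs⟩ : ∃ qs : List (Γ ⊕ Fin m), qs.map (Sum.elim (fun a => [a]) e) = ps := by
      clear hps
      induction ps with
      | nil => exact ⟨[], rfl⟩
      | cons p ps ih =>
        obtain ⟨x, hx⟩ := hps' p (by simp)
        obtain ⟨qs, hqs⟩ := ih fun q hq => hps' q (by simp [hq])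
        exact ⟨x :: qs, by simp [hx, hqs]⟩
    let s : Γ ⊕ Fin m → Γ ⊕ Fin (m + 1) := Sum.map id Fin.succ
    let e' : Fin (m + 1) → List Γ := Fin.cons ps.flatten e
    have hs : ∀ l : List (Γ ⊕ Fin m), (l.map s).flatMap (Sum.elim (fun a => [a]) e') =
        l.flatMap (Sum.elim (fun a => [a]) e) := fun l => by
      rw [List.flatMap_map]
      congr 1
      funext x
      cases x <;> simp [s, e']
    have hsucc : ∀ {l : List (Γ ⊕ Fin m)} {y}, Sum.inr y ∈ l.map s →
        ∃ z, Sum.inr z ∈ l ∧ y = z.succ := fun {l y} hy => by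
      obtain ⟨x, hx, hxy⟩ := List.mem_map.1 hy
      cases x with
      | inl a => simp [s] at hxy
      | inr z => exact ⟨z, hx, by simpa [s, eq_comm] using hxy⟩
    refine ⟨m + 1, Fin.cons (qs.map s) fun x => (P x).map s, e', ?_, ?_, ?_, ?_⟩
    · intro x y hy
      refine Fin.cases (fun hy => ?_) (fun x hy => ?_) x hy
      · obtain ⟨z, -, rfl⟩ := hsucc hy
        exact Fin.succ_pos z
      · obtain ⟨z, hz, rfl⟩ := hsucc hy
        exact Fin.succ_lt_succ_iff.2 (hlt x z hz)
    · rw [Fin.sum_univ_succ]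
      simp [hsum, ← hqs, Nat.add_comm]
    · refine Fin.cases ?_ fun x => ?_
      · rw [Fin.cons_zero, hs, List.flatMap_def, hqs]
        rfl
      · rw [Fin.cons_succ, hs, ← he]
        rfl
    · intro w hw
      rcases List.mem_cons.1 hw with rfl | hw
      · exact ⟨0, rfl⟩
      · obtain ⟨x, rfl⟩ := hW w hw
        exact ⟨x.succ, rfl⟩

end Straight

namespace SLP

variable {Γ V : Type} {H : SLP Γ V}

theorem Rw.append_left (u : List (Γ ⊕ V)) {x y : List (Γ ⊕ V)} (h : H.Rw x y) :
    H.Rw (u ++ x) (u ++ y) := by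
  cases h with
  | step a v b => simpa using Rw.step (H := H) (u ++ a) v b

theorem Rw.append_right (u : List (Γ ⊕ V)) {x y : List (Γ ⊕ V)} (h : H.Rw x y) :
    H.Rw (x ++ u) (y ++ u) := by
  cases h with
  | step a v b => simpa using Rw.step (H := H) a v (b ++ u)

theorem reflTransGen_append {x x' y y' : List (Γ ⊕ V)} (hx : Relation.ReflTransGen H.Rw x x')
    (hy : Relation.ReflTransGen H.Rw y y') : Relation.ReflTransGen H.Rw (x ++ y) (x' ++ y') :=
  (hx.lift (· ++ y) fun _ _ => Rw.append_right y).trans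
    (hy.lift (x' ++ ·) fun _ _ => Rw.append_left x')

theorem reflTransGen_flatMap (e : V → List Γ) : ∀ l : List (Γ ⊕ V),
    (∀ y, Sum.inr y ∈ l → Relation.ReflTransGen H.Rw [.inr y] ((e y).map .inl)) →
      Relation.ReflTransGen H.Rw l ((l.flatMap (Sum.elim (fun a => [a]) e)).map .inl)
  | [], _ => .refl
  | x :: l, h => by
    rw [List.flatMap_cons, List.map_append]
    refine reflTransGen_append (x := [x]) ?_
      (reflTransGen_flatMap e l fun y hy => h y (List.mem_cons_of_mem _ hy))
    cases x with
    | inl a => exact .refl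
    | inr y => exact h y (by simp)

theorem reflTransGen_of_eq_flatMap [Finite V] [Preorder V] {e : V → List Γ}
    (hlt : ∀ x y, Sum.inr y ∈ H.P x → x < y)
    (he : ∀ x, e x = (H.P x).flatMap (Sum.elim (fun a => [a]) e)) (x : V) :
    Relation.ReflTransGen H.Rw [.inr x] ((e x).map .inl) := by
  induction x using WellFoundedGT.induction with
  | ind x ih =>
    rw [he x]
    have := reflTransGen_flatMap (H := H) e (H.P x) fun y hy => ih y (hlt x y hy)
    exact .head (by simpa using Rw.step (H := H) [] x []) this

end SLP

theorem Straight.exists_slp {Γ : Type} {W : List (List Γ)} {c : ℕ} (h : Straight W c)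
    {w : List Γ} (hw : w ∈ W) :
    ∃ (m : ℕ) (H : SLP Γ (Fin m)), SLP.size H = c ∧ H.Generates w := by
  obtain ⟨m, P, e, hlt, hsum, he, hW⟩ := h.exists_rules
  obtain ⟨x, rfl⟩ := hW w hw
  have hacyc : ∀ v, ¬ Relation.TransGen (fun x y => Sum.inr y ∈ P x) v v := fun v hv => by
    have hmono : ∀ a b, Relation.TransGen (fun x y => Sum.inr y ∈ P x) a b → a < b := by
      intro a b hab
      induction hab with
      | single h => exact hlt _ _ h
      | tail _ h ih => exact ih.trans (hlt _ _ h)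
    exact lt_irrefl v (hmono v v hv)
  exact ⟨m, ⟨x, P, hacyc⟩, hsum, SLP.reflTransGen_of_eq_flatMap hlt he x⟩

namespace PTree

variable {L N X : Type}

theorem paramList_nt (A : N) (ts : List (PTree L N)) :
    paramList (.nt A ts) = (ts.map paramList).flatten := by
  rw [paramList, List.attach_map_val]

theorem nodeCount_nt (A : N) (ts : List (PTree L N)) :
    nodeCount (.nt A ts) = 1 + (ts.map nodeCount).sum := by
  rw [nodeCount, List.attach_map_val]

theorem subst_nt (env : List (PTree L N)) (A : N) (ts : List (PTree L N)) :
    subst env (.nt A ts) = .nt A (ts.map (subst env)) := by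
  rw [subst, List.attach_map_val]

theorem nodeCount_pos (t : PTree L N) : 0 < nodeCount t := by
  cases t <;> rw [nodeCount] <;> omega

theorem rec_mem {motive : PTree L N → Prop} (leaf : motive .leaf) (param : ∀ i, motive (.param i))
    (term : ∀ a l r, motive l → motive r → motive (.term a l r))
    (nt : ∀ A ts, (∀ t ∈ ts, motive t) → motive (.nt A ts)) : ∀ t, motive t
  | .leaf => leaf
  | .param i => param i
  | .term a l r =>
    term a l r (rec_mem leaf param term nt l) (rec_mem leaf param term nt r)
  | .nt A ts => nt A ts fun t _ => rec_mem leaf param term nt t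

/-- The value of a tree in an algebra with constant `z` and binary operations `f a`, where the
nonterminals are interpreted by `v` and the parameters by `env`. -/
def interp (z : X) (f : L → X → X → X) (v : N → (ℕ → X) → X) (env : ℕ → X) : PTree L N → X
  | .leaf => z
  | .param i => env i
  | .term a l r => f a (interp z f v env l) (interp z f v env r)
  | .nt B ts => v B fun i => (ts.attach.map fun t => interp z f v env t.1).getD (i - 1) z
decreasing_by
  all_goals simp_wf
  all_goals try omega
  all_goals (have := List.sizeOf_lt_of_mem t.2; omega)

section interp

variable {z : X} {f : L → X → X → X} {v : N → (ℕ → X) → X}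

theorem interp_nt (env : ℕ → X) (B : N) (ts : List (PTree L N)) :
    interp z f v env (.nt B ts) = v B fun i => (ts.map (interp z f v env)).getD (i - 1) z := by
  rw [interp, List.attach_map_val]

theorem interp_subst (env : ℕ → X) (es : List (PTree L N)) (t : PTree L N) :
    interp z f v env (subst es t) =
      interp z f v (fun i => (es.map (interp z f v env)).getD (i - 1) z) t := by
  induction t using rec_mem with
  | leaf => simp [subst, interp]
  | param i =>
    have h : interp z f v env .leaf = z := by rw [interp]
    rw [subst, interp, ← List.getD_map (f := interp z f v env), h]
  | term a l r hl hr => rw [subst, interp, interp, hl, hr]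
  | nt A ts ih => 
    rw [subst_nt, interp_nt, interp_nt, List.map_map, ← List.map_congr_left ih]
    rfl

theorem interp_congr {v' : N → (ℕ → X) → X} (env : ℕ → X) (t : PTree L N)
    (h : ∀ B, Occurs B t → v B = v' B) : interp z f v env t = interp z f v' env t := by
  induction t using rec_mem with
  | leaf => rw [interp, interp]
  | param i => rw [interp, interp]
  | term a l r hl hr =>
    rw [interp, interp, hl fun B hB => h B (.term_left a hB), hr fun B hB => h B (.term_right a hB)]
  | nt A ts ih =>
    rw [interp_nt, interp_nt, h A (.here ts),
      List.map_congr_left fun t ht => ih t ht fun B hB => h B (.nt A ht hB)]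

theorem interp_term_eq_self {w : N → (ℕ → PTree L N) → PTree L N} {t : PTree L N} (ht : Ground t)
    (env : ℕ → PTree L N) : interp .leaf .term w env t = t := by
  induction ht with
  | leaf => rw [interp]
  | term a _ _ hl hr => rw [interp, hl, hr]

/-- The operation on serializations that corresponds to adding a root labeled `a`. -/
def wrap (a : L) (x y : List (L × Bool)) : List (L × Bool) :=
  (a, false) :: (x ++ y ++ [(a, true)])

theorem interp_wrap_eq_serialize {w : N → (ℕ → List (L × Bool)) → List (L × Bool)}
    {t : PTree L N} (ht : Ground t) (env : ℕ → List (L × Bool)) :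
    interp [] wrap w env t = serialize t := by
  induction ht with
  | leaf => rw [interp, serialize]
  | term a _ _ hl hr => rw [interp, hl, hr, wrap, serialize]

end interp

theorem isInfix_serialize_subtreeAt (t : PTree L N) (p : List Bool) :
    (t.subtreeAt p).serialize <:+: t.serialize := by
  induction t, p using subtreeAt.induct with
  | case1 t => simp [subtreeAt]
  | case2 a l r b p ih =>
    rw [subtreeAt]
    refine ih.trans ?_
    cases b
    · exact ⟨[(a, false)], r.serialize ++ [(a, true)], by simp [serialize]⟩
    · exact ⟨(a, false) :: l.serialize, [(a, true)], by simp [serialize]⟩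
  | case3 t b p ht =>
    rw [subtreeAt]
    exact ht

end PTree

namespace SLT

variable {L N X : Type} {z : X} {f : L → X → X → X}

theorem exists_interp [Fintype N] (G : SLT L N) (z : X) (f : L → X → X → X) :
    ∃ v : N → (ℕ → X) → X, ∀ A env, v A env = PTree.interp z f v env (G.P A) := by
  classical
  suffices h : ∃ v : N → (ℕ → X) → X,
      ∀ A ∈ (Finset.univ : Finset N), ∀ env, v A env = PTree.interp z f v env (G.P A) by
    simpa using h
  refine Finset.univ_of_acyclic_induction G.acyclic (motive := fun S =>
    ∃ v : N → (ℕ → X) → X, ∀ A ∈ S, ∀ env, v A env = PTree.interp z f v env (G.P A))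
    ⟨fun _ _ => z, by simp⟩ ?_
  rintro S A hA hclosed hsucc ⟨v, hv⟩
  have hupd : ∀ B ∈ S, ∀ x, v B = Function.update v A x B := fun B hB x => by
    rw [Function.update_of_ne]
    rintro rfl
    exact hA hB
  refine ⟨Function.update v A fun env => PTree.interp z f v env (G.P A), fun B hB env => ?_⟩
  rcases Finset.mem_insert.1 hB with rfl | hB
  · rw [Function.update_self]
    exact PTree.interp_congr env _ fun C hC => hupd C (hsucc C hC) _
  · rw [← hupd B hB, hv B hB]
    exact PTree.interp_congr env _ fun C hC => hupd C (hclosed B hB C hC) _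

theorem Rw.interp_eq {G : SLT L N} {v : N → (ℕ → X) → X}
    (hv : ∀ A env, v A env = PTree.interp z f v env (G.P A)) (env : ℕ → X) {t t' : PTree L N}
    (h : G.Rw t t') : PTree.interp z f v env t = PTree.interp z f v env t' := by
  induction h with
  | head A ts => rw [PTree.interp_nt, hv, PTree.interp_subst]
  | term_left a r _ ih => rw [PTree.interp, PTree.interp, ih]
  | term_right a l _ ih => rw [PTree.interp, PTree.interp, ih]
  | nt_child B l r _ ih =>
    simp only [PTree.interp_nt, List.map_append, List.map_cons, ih]

theorem interp_eq_of_reflTransGen {G : SLT L N} {v : N → (ℕ → X) → X}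
    (hv : ∀ A env, v A env = PTree.interp z f v env (G.P A)) (env : ℕ → X) {t t' : PTree L N}
    (h : Relation.ReflTransGen G.Rw t t') :
    PTree.interp z f v env t = PTree.interp z f v env t' := by
  induction h with
  | refl => rfl
  | tail _ h ih => exact ih.trans (h.interp_eq hv env)

theorem ground_unique [Fintype N] {G : SLT L N} {s t t' : PTree L N} (ht : t.Ground)
    (ht' : t'.Ground) (h : Relation.ReflTransGen G.Rw s t) (h' : Relation.ReflTransGen G.Rw s t') :
    t = t' := by
  obtain ⟨v, hv⟩ := G.exists_interp PTree.leaf (PTree.term (N := N))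
  have := (interp_eq_of_reflTransGen hv (fun _ => .leaf) h).symm.trans
    (interp_eq_of_reflTransGen hv (fun _ => .leaf) h')
  rwa [PTree.interp_term_eq_self ht, PTree.interp_term_eq_self ht'] at this

end SLT

/-- `Factors W f ps n` means that the string function `f` of an environment is the concatenation of
`n` pieces available from `W` and of the values of the parameters `ps`, in this order. -/
inductive Factors {Γ : Type} (W : List (List Γ)) :
    ((ℕ → List Γ) → List Γ) → List ℕ → ℕ → Prop
  | nil : Factors W (fun _ => []) [] 0
  | piece {f : (ℕ → List Γ) → List Γ} {ps : List ℕ} {n : ℕ} {w : List Γ} :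
      IsPiece W w → Factors W f ps n → Factors W (fun e => w ++ f e) ps (n + 1)
  | param {f : (ℕ → List Γ) → List Γ} {ps : List ℕ} {n : ℕ} (i : ℕ) :
      Factors W f ps n → Factors W (fun e => e i ++ f e) (i :: ps) n

/-- A function of `k` strings that is given by interleaving its arguments with `k + 1` strings,
all of which lie in `W`. -/
def HasGaps {Γ : Type} (W : List (List Γ)) (k : ℕ) (f : (ℕ → List Γ) → List Γ) : Prop :=
  ∃ g ∈ W, ∃ gs : List (List Γ), gs.length = k ∧ (∀ w ∈ gs, w ∈ W) ∧
    ∀ xs : List (List Γ), xs.length = k →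
      f (fun i => xs.getD (i - 1) []) = g ++ (List.zipWith (· ++ ·) xs gs).flatten

theorem HasGaps.mono {Γ : Type} {W W' : List (List Γ)} (h : ∀ w ∈ W, w ∈ W') {k : ℕ}
    {f : (ℕ → List Γ) → List Γ} (hf : HasGaps W k f) : HasGaps W' k f := by
  obtain ⟨g, hg, gs, hlen, hgs, hval⟩ := hf
  exact ⟨g, h g hg, gs, hlen, fun w hw => h w (hgs w hw), hval⟩

namespace Factors

variable {Γ : Type} {W : List (List Γ)} {f g : (ℕ → List Γ) → List Γ} {ps qs : List ℕ} {m n : ℕ}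

theorem append (hf : Factors W f ps m) (hg : Factors W g qs n) :
    Factors W (fun e => f e ++ g e) (ps ++ qs) (m + n) := by
  induction hf with
  | nil => simpa using hg
  | piece hw _ ih =>
    have := ih.piece hw
    simpa [Nat.add_right_comm] using this
  | param i _ ih => simpa using ih.param i

theorem exists_groups (hf : Factors W f ps n) :
    ∃ (g : List (List Γ)) (gs : List (List (List Γ))), gs.length = ps.length ∧
      (∀ w ∈ g, IsPiece W w) ∧ (∀ l ∈ gs, ∀ w ∈ l, IsPiece W w) ∧
      g.length + (gs.map List.length).sum = n ∧
      ∀ e, f e = g.flatten ++ (List.zipWith (· ++ ·) (ps.map e) (gs.map List.flatten)).flatten := by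
  induction hf with
  | nil => exact ⟨[], [], by simp⟩
  | @piece f ps n w hw _ ih =>
    obtain ⟨g, gs, hlen, hg, hgs, hsum, hval⟩ := ih
    refine ⟨w :: g, gs, hlen, ?_, hgs, by rw [List.length_cons]; omega, fun e => by simp [hval]⟩
    simpa using ⟨hw, hg⟩
  | @param f ps n i _ ih =>
    obtain ⟨g, gs, hlen, hg, hgs, hsum, hval⟩ := ih
    refine ⟨[], g :: gs, by simp [hlen], by simp, ?_, by simpa using hsum,
      fun e => by simp [hval]⟩
    simpa using ⟨hg, hgs⟩

theorem exists_hasGaps {c k : ℕ} (hW : Straight W c) (hf : Factors W f (List.range' 1 k) n) :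
    ∃ W', Straight W' (c + n) ∧ (∀ w ∈ W, w ∈ W') ∧ HasGaps W' k f := by
  obtain ⟨g, gs, hlen, hg, hgs, hsum, hval⟩ := hf.exists_groups
  have h := hW.append_flatten (g :: gs) (by simpa using ⟨hg, hgs⟩)
  rw [List.map_cons, List.map_cons, List.sum_cons, hsum] at h
  refine ⟨_, h, fun w hw => by simp [hw], g.flatten, by simp, gs.map List.flatten,
    by simpa using hlen, fun w hw => by simp [hw], fun xs hxs => ?_⟩
  have : (List.range' 1 k).map (fun i => xs.getD (i - 1) []) = xs := by
    refine List.ext_getElem (by simp [hxs]) fun i h₁ h₂ => ?_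
    simp [List.getD_eq_getElem?_getD, List.getElem?_eq_getElem h₂]
  rw [hval, this]

end Factors

namespace PTree

variable {L N : Type}

theorem factors_of_hasGaps {rank : N → ℕ} {W : List (List (L × Bool))}
    {v : N → (ℕ → List (L × Bool)) → List (L × Bool)} {t : PTree L N} (harity : ArityOk rank t)
    (hv : ∀ B, Occurs B t → HasGaps W (rank B) (v B)) :
    ∃ n, n + 1 ≤ 3 * nodeCount t ∧
      Factors W (fun env => interp [] wrap v env t) (paramList t) n := by
  induction t using rec_mem with
  | leaf => exact ⟨0, by simp [nodeCount], by simpa [interp, paramList] using Factors.nil⟩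
  | param i =>
    exact ⟨0, by simp [nodeCount], by simpa [interp, paramList] using Factors.nil.param i⟩
  | term a l r hl hr =>
    cases harity with
    | term _ al ar =>
    obtain ⟨n₁, hn₁, h₁⟩ := hl al fun B hB => hv B (.term_left a hB)
    obtain ⟨n₂, hn₂, h₂⟩ := hr ar fun B hB => hv B (.term_right a hB)
    have h := ((h₁.append h₂).append (Factors.nil.piece (.inr ⟨(a, true), rfl⟩))).piece
      (.inr ⟨(a, false), rfl⟩)
    exact ⟨n₁ + n₂ + (0 + 1) + 1, by rw [nodeCount]; omega, by simpa [interp, wrap, paramList] using h⟩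
  | nt A ts ih =>
    cases harity with
    | nt _ hlen hts =>
    obtain ⟨g, hg, gs, hgs, hmem, hval⟩ := hv A (.here ts)
    have hinterp : ∀ env, interp [] wrap v env (.nt A ts) =
        g ++ (List.zipWith (· ++ ·) (ts.map (interp [] wrap v env)) gs).flatten := fun env => by
      rw [interp_nt, hval _ (by simpa using hlen)]
    have hih : ∀ t ∈ ts, ∃ n, n + 1 ≤ 3 * nodeCount t ∧
        Factors W (fun env => interp [] wrap v env t) (paramList t) n := fun t ht =>
      ih t ht (hts t ht) fun B hB => hv B (.nt A ht hB)
    have key : ∀ (us : List (PTree L N)) (hs : List (List (L × Bool))), us.length = hs.length →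
        (∀ t ∈ us, t ∈ ts) → (∀ w ∈ hs, w ∈ W) → ∃ n, n ≤ 3 * (us.map nodeCount).sum ∧
          Factors W (fun env =>
            (List.zipWith (· ++ ·) (us.map (interp [] wrap v env)) hs).flatten)
            (us.map paramList).flatten n := by
      intro us
      induction us with
      | nil => exact fun hs _ _ _ => ⟨0, by simp, by simpa using Factors.nil⟩
      | cons u us ihu =>
        rintro (- | ⟨w, hs⟩) hl hu hw
        · simp at hl
        obtain ⟨n₁, hn₁, h₁⟩ := hih u (hu u (by simp))
        obtain ⟨n₂, hn₂, h₂⟩ := ihu hs (by simpa using hl) (fun t ht => hu t (by simp [ht]))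
          fun x hx => hw x (by simp [hx])
        have h := h₁.append (h₂.piece (.inl (hw w (by simp))))
        exact ⟨n₁ + (n₂ + 1), by rw [List.map_cons, List.sum_cons]; omega, by simpa using h⟩
    obtain ⟨n, hn, h⟩ := key ts gs (hlen.trans hgs.symm) (fun _ => id) hmem
    refine ⟨n + 1, by rw [nodeCount_nt]; omega, ?_⟩
    simpa only [hinterp, paramList_nt] using h.piece (.inl hg)

theorem exists_hasGaps {rank : N → ℕ} {W : List (List (L × Bool))} {c k : ℕ}
    {v : N → (ℕ → List (L × Bool)) → List (L × Bool)} {t : PTree L N} (hW : Straight W c)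
    (harity : ArityOk rank t) (hparam : paramList t = List.range' 1 k)
    (hv : ∀ B, Occurs B t → HasGaps W (rank B) (v B)) :
    ∃ W' c', Straight W' c' ∧ c' ≤ c + 6 * (nodeCount t - 1) ∧ (∀ w ∈ W, w ∈ W') ∧
      HasGaps W' k (fun env => interp [] wrap v env t) := by
  suffices h : HasGaps W k (fun env => interp [] wrap v env t) ∨ ∃ n ≤ 6 * (nodeCount t - 1),
      Factors W (fun env => interp [] wrap v env t) (paramList t) n by
    rcases h with h | ⟨n, hn, h⟩
    · exact ⟨W, c, hW, by omega, fun _ => id, h⟩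
    · rw [hparam] at h
      obtain ⟨W', hW', hsub, hgaps⟩ := h.exists_hasGaps hW
      exact ⟨W', _, hW', by omega, hsub, hgaps⟩
  have hlarge : 2 ≤ nodeCount t → ∃ n ≤ 6 * (nodeCount t - 1),
      Factors W (fun env => interp [] wrap v env t) (paramList t) n := fun h2 => by
    obtain ⟨n, hn, h⟩ := factors_of_hasGaps harity hv
    exact ⟨n, by omega, h⟩
  cases t with
  | leaf => exact .inr ⟨0, by simp, by simpa [interp, paramList] using Factors.nil⟩
  | param i => exact .inr ⟨0, by simp, by simpa [interp, paramList] using Factors.nil.param i⟩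
  | term a l r =>
    have := nodeCount_pos l
    exact .inr (hlarge (by rw [nodeCount]; omega))
  | nt A ts =>
    rcases ts with - | ⟨t, ts⟩
    · left
      have hk : k = 0 := by simpa [paramList_nt, eq_comm] using congrArg List.length hparam
      cases harity with
      | nt _ hlen _ =>
      obtain ⟨g, hg, gs, hgs, hmem, hval⟩ := hv A (.here [])
      have hrank : rank A = 0 := hlen.symm
      refine ⟨g, hg, gs, hgs.trans (hrank.trans hk.symm), hmem, fun xs hxs => ?_⟩
      obtain rfl : xs = [] := List.length_eq_zero_iff.1 (hxs.trans hk)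
      simpa only [interp_nt, List.map_nil] using hval [] hlen
    · have := nodeCount_pos t
      exact .inr (hlarge (by rw [nodeCount_nt, List.map_cons, List.sum_cons]; omega))

end PTree

theorem SLT.exists_straight {L N : Type} [Fintype N] (G : SLT L N) {t : PTree L N}
    (ht : t.Ground) (h : Relation.ReflTransGen G.Rw (G.P G.start) t) :
    ∃ W c, Straight W c ∧ c ≤ 6 * G.size ∧ t.serialize ∈ W := by
  classical
  obtain ⟨v, hv⟩ := G.exists_interp [] PTree.wrap
  obtain ⟨W, c, hW, hc, hgaps⟩ : ∃ W c, Straight W c ∧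
      c ≤ ∑ A ∈ Finset.univ, 6 * ((G.P A).nodeCount - 1) ∧
      ∀ A ∈ Finset.univ, HasGaps W (G.rank A) (v A) := by
    refine Finset.univ_of_acyclic_induction G.acyclic
      (motive := fun S => ∃ W c, Straight W c ∧ c ≤ ∑ A ∈ S, 6 * ((G.P A).nodeCount - 1) ∧
        ∀ A ∈ S, HasGaps W (G.rank A) (v A)) ⟨[], 0, .nil, by simp⟩ ?_
    rintro S A hA - hsucc ⟨W, c, hW, hc, hgaps⟩
    obtain ⟨W', c', hW', hc', hsub, hA'⟩ := PTree.exists_hasGaps hW (G.arity A) (G.params A)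
      fun B hB => hgaps B (hsucc B hB)
    refine ⟨W', c', hW', by rw [Finset.sum_insert hA]; omega, fun B hB => ?_⟩
    rcases Finset.mem_insert.1 hB with rfl | hB
    · rwa [← funext (hv B)] at hA'
    · exact (hgaps B hB).mono hsub
  refine ⟨W, c, hW, by rwa [SLT.size, Finset.mul_sum], ?_⟩
  obtain ⟨g, hg, gs, -, -, hval⟩ := hgaps G.start (Finset.mem_univ _)
  have := hval [] G.rank_start.symm
  rw [hv, interp_eq_of_reflTransGen hv _ h, PTree.interp_wrap_eq_serialize ht] at this
  simpa [this] using hg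

/-- There is a constant `c > 0` such that for every SLT
grammar `G` and every subset `R` of the nodes of the tree derived by `G`
(given as the list `rs` of its positions in pre-order), there is a
straight-line program of size `O(|G|·|R|)` that generates the concatenation,
in pre-order of the nodes of `R`, of the serializations of the subtrees
rooted at the nodes in `R`. -/
theorem slp_for_selected_subtrees :
    ∃ c : ℕ, 0 < c ∧
      ∀ (L N : Type) [Fintype N] (G : SLT L N) (rs : List (List Bool)),
        ∃ (m : ℕ) (H : SLP (L × Bool) (Fin m)),
          SLP.size H ≤ c * (SLT.size G + 1) * (rs.length + 1) ∧
          ∀ t : PTree L N, PTree.Ground t →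
            Relation.ReflTransGen (SLT.Rw G) (G.P G.start) t →
            (∀ p ∈ rs, PTree.ValidPos t p) → rs.Pairwise preLt →
            H.Generates (rs.map (fun p => (t.subtreeAt p).serialize)).flatten := by
  refine ⟨25, by norm_num, fun L N _ G rs => ?_⟩
  by_cases ht : ∃ t : PTree L N, t.Ground ∧ Relation.ReflTransGen (SLT.Rw G) (G.P G.start) t
  · obtain ⟨t, hground, hderiv⟩ := ht
    obtain ⟨W, c, hW, hc, hmem⟩ := G.exists_straight hground hderiv
    obtain ⟨W', c', hW', hc', hmem'⟩ := Straight.exists_flatten (b := 4 * c)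
      (us := rs.map fun p => (t.subtreeAt p).serialize) fun u hu => by
        obtain ⟨p, -, rfl⟩ := List.mem_map.1 hu
        exact hW.exists_of_isInfix_mem hmem (t.isInfix_serialize_subtreeAt p)
    obtain ⟨m, H, hsize, hgen⟩ := hW'.exists_slp hmem'
    refine ⟨m, H, ?_, fun t' hground' hderiv' _ _ => ?_⟩
    · rw [hsize]
      rw [List.length_map] at hc'
      calc c' ≤ rs.length * (4 * c + 1) := hc'
        _ ≤ (rs.length + 1) * (25 * (SLT.size G + 1)) := Nat.mul_le_mul (by omega) (by omega)
        _ = _ := Nat.mul_comm _ _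
    · rwa [← SLT.ground_unique hground hground' hderiv hderiv']
  · obtain ⟨m, H, hsize, -⟩ := (Straight.nil.cons (Γ := L × Bool) [] (by simp)).exists_slp
      (List.mem_singleton_self _)
    exact ⟨m, H, by simp [hsize], fun t hground hderiv => absurd ⟨t, hground, hderiv⟩ ht⟩
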